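/- Under hypotheses (C1)–(C6), suppose there exist real numbers r, R with 0 < r < R such that (i) max{ λ·f̄_R·K + η1·γ1(1)·H_{1,R} + η2·γ2(1)·H_{2,R}, λ·f̄_R·K* + η1·‖γ1'‖_∞·H_{1,R} + η2·‖γ2'‖_∞·H_{2,R} } ≤ R, and (ii) λ·f̲_r·min{K, K*} ≥ r. Then the perturbed Hammerstein integral equation u(t) = η1 γ1(t) h1[u] + η2 γ2(t) h2[u] + λ ∫₀¹ k(t,s) f(s, u(s), u'(s)) ds has a solution u ∈ P with r ≤ ‖u‖ ≤ R. -/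

import Mathlib

open MeasureTheory Set Bornology

noncomputable section

/-- The interval `[0,1]`. -/
abbrev I01 : Set ℝ := Set.Icc 0 1

/-- The space `C[0,1] × C[0,1]`; an element of `C¹[0,1]` is encoded as the pair `(u, u')`.
The product norm is exactly `‖(u,u')‖ = max {‖u‖_∞, ‖u'‖_∞}`. -/
abbrev E := C(I01, ℝ) × C(I01, ℝ)

/-- The extension to `ℝ` of a continuous function on `[0,1]` (constant outside `[0,1]`). -/
def ext01 (g : C(I01, ℝ)) : ℝ → ℝ := Set.IccExtend zero_le_one ⇑g

/-- `p = (u, u')` encodes a `C¹` function: `u'` is the derivative of `u` on `[0,1]`. -/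
def IsC1 (p : E) : Prop :=
  ∀ t : I01, HasDerivWithinAt (ext01 p.1) (p.2 t) I01 (t : ℝ)

/-- The cone `P` of non-negative `C¹[0,1]` functions with non-negative derivative. -/
def coneP : Set E :=
  {p | IsC1 p ∧ ∀ t : I01, 0 ≤ p.1 t ∧ 0 ≤ p.2 t}

/-- `f̄_ρ = max_{[0,1]×[0,ρ]²} f`. -/
def fSup (f : ℝ → ℝ → ℝ → ℝ) (ρ : ℝ) : ℝ :=
  ⨆ x : I01 × Icc (0:ℝ) ρ × Icc (0:ℝ) ρ, f (x.1 : ℝ) (x.2.1 : ℝ) (x.2.2 : ℝ)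

/-- `f̲_ρ = min_{[0,1]×[0,ρ]²} f`. -/
def fInf (f : ℝ → ℝ → ℝ → ℝ) (ρ : ℝ) : ℝ :=
  ⨅ x : I01 × Icc (0:ℝ) ρ × Icc (0:ℝ) ρ, f (x.1 : ℝ) (x.2.1 : ℝ) (x.2.2 : ℝ)

/-- `H_{i,ρ} = sup {h_i[u] : u ∈ ∂P_ρ}`. -/
def Hsup (h : E → ℝ) (ρ : ℝ) : ℝ := sSup (h '' {p ∈ coneP | ‖p‖ = ρ})

/-- `K = ∫₀¹ k(1,s) ds`. -/
def Kconst (k : ℝ → ℝ → ℝ) : ℝ := ∫ s in (0:ℝ)..1, k 1 s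

/-- `K* = sup_{t∈[0,1]} ∫₀¹ ∂ₜk(t,s) ds`. -/
def Kstar (kt : ℝ → ℝ → ℝ) : ℝ := ⨆ t : I01, ∫ s in (0:ℝ)..1, kt (t : ℝ) s

/-- `‖g‖_∞` for a raw function (sup over `[0,1]`). -/
def supNorm (g : ℝ → ℝ) : ℝ := ⨆ t : I01, |g (t : ℝ)|

section Brouwer

open Polynomial in
theorem exists_polynomial_det_one_add_smul {V : Type*} [NormedAddCommGroup V] [NormedSpace ℝ V]
    [FiniteDimensional ℝ V] (A : V →L[ℝ] V) :
    ∃ q : ℝ[X], q.natDegree ≤ Module.finrank ℝ V ∧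
      ∀ t : ℝ, q.eval t = (1 + t • A).det := by
  let b := Module.finBasis ℝ V
  let M := LinearMap.toMatrix b b (A : V →ₗ[ℝ] V)
  refine ⟨((X : ℝ[X]) • M.map C + (1 : Matrix _ _ ℝ).map C).det, ?_, fun t => ?_⟩
  · simpa using natDegree_det_X_add_C_le M 1
  · have h : ((1 + t • A : V →L[ℝ] V) : V →ₗ[ℝ] V) = LinearMap.id + t • (A : V →ₗ[ℝ] V) := rfl
    have h' : LinearMap.toMatrix b b (LinearMap.id + t • (A : V →ₗ[ℝ] V)) = 1 + t • M := by
      rw [map_add, LinearMap.toMatrix_id, map_smul]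
    rw [ContinuousLinearMap.det, ← LinearMap.det_toMatrix b, ← coe_evalRingHom, RingHom.map_det,
      h, h']
    congr 1
    ext i j
    rcases eq_or_ne i j with rfl | hij
    · simp
      ring
    · simp [hij]
      ring

open Polynomial in
/-- Lagrange extrapolation: a polynomial value is a fixed combination of values at `n + 1` nodes. -/
theorem exists_extrapolation_weights (n : ℕ) {δ : ℝ} (hδ : 0 < δ) :
    ∃ (v w : Fin (n + 1) → ℝ), (∀ i, 0 < v i ∧ v i < δ) ∧ ∑ i, w i = 1 ∧
      ∀ q : ℝ[X], q.natDegree ≤ n → q.eval 1 = ∑ i, w i * q.eval (v i) := by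
  let v : Fin (n + 1) → ℝ := fun i => δ * ((i + 1 : ℝ) / (n + 2))
  have hv : Function.Injective v := by
    intro i j h
    have hn : (n + 2 : ℝ) ≠ 0 := by positivity
    simp only [v] at h
    field_simp at h
    ext
    exact_mod_cast (add_right_cancel h : (i : ℝ) = j)
  have key : ∀ q : ℝ[X], q.natDegree ≤ n →
      q.eval 1 = ∑ i, (Lagrange.basis Finset.univ v i).eval 1 * q.eval (v i) := by
    intro q hq
    have hd : q.degree < (Finset.univ : Finset (Fin (n + 1))).card := by
      refine lt_of_le_of_lt q.degree_le_natDegree ?_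
      simp
      exact_mod_cast Nat.lt_succ_of_le hq
    conv_lhs => rw [Lagrange.eq_interpolate (s := Finset.univ) hv.injOn hd]
    simp [Lagrange.interpolate_apply, eval_finsetSum, mul_comm]
  refine ⟨v, fun i => (Lagrange.basis Finset.univ v i).eval 1, fun i => ⟨by positivity, ?_⟩, ?_,
    key⟩
  · have : ((i : ℝ) + 1) / (n + 2) < 1 := by
      rw [div_lt_one (by positivity)]
      have : ((i : ℕ) : ℝ) ≤ n := by exact_mod_cast Nat.lt_succ_iff.1 i.2
      linarith
    simpa [v] using mul_lt_mul_of_pos_left this hδ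
  · simpa using (key 1 (by simp)).symm

variable {V : Type*} [NormedAddCommGroup V] [NormedSpace ℝ V]

theorem bijective_add_of_lipschitz [CompleteSpace V] {h : V → V} {L : NNReal}
    (hh : LipschitzWith L h) {t : ℝ} (ht : ‖t‖₊ * L < 1) :
    Function.Bijective fun x => x + t • h x := by
  have hc : ∀ y, ContractingWith (‖t‖₊ * L) fun x => y - t • h x := fun y =>
    ⟨ht, LipschitzWith.of_dist_le_mul fun a b => by
      have := hh.dist_le_mul a b
      rw [dist_sub_left, dist_smul₀]
      push_cast
      rw [mul_assoc]
      gcongr⟩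
  constructor
  · intro a b hab
    exact (hc (a + t • h a)).fixedPoint_unique' (by simp [Function.IsFixedPt])
      (by simpa [Function.IsFixedPt, sub_eq_iff_eq_add] using hab)
  · intro y
    have := (hc y).fixedPoint_isFixedPt
    exact ⟨_, by
      simp only [Function.IsFixedPt] at this
      exact (eq_sub_iff_add_eq.1 this.symm)⟩

theorem lipschitzWith_indicator_closedBall {h : V → V} {L : NNReal} {ρ : ℝ}
    (hh : LipschitzOnWith L h (Metric.closedBall 0 ρ)) (h0 : ∀ x, ‖x‖ = ρ → h x = 0) :
    LipschitzWith L ((Metric.closedBall (0 : V) ρ).indicator h) := by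
  have aux : ∀ x y : V, ‖x‖ ≤ ρ → ρ < ‖y‖ → ‖h x‖ ≤ L * dist x y := by
    intro x y hx hy
    have hcont : ContinuousOn (fun s : ℝ => ‖AffineMap.lineMap x y s‖) (Icc (0:ℝ) 1) := by
      apply Continuous.continuousOn
      exact (AffineMap.lineMap_continuous).norm
    obtain ⟨s, hs, hsρ⟩ := intermediate_value_Icc (zero_le_one) hcont
      (show ρ ∈ Icc _ _ by simpa using ⟨hx, hy.le⟩)
    simp only at hsρ
    have h1 := hh.dist_le_mul x (by simpa using hx) (AffineMap.lineMap x y s) (by simp [hsρ])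
    rw [h0 _ hsρ, dist_zero_right, dist_left_lineMap] at h1
    refine h1.trans ?_
    gcongr
    rw [Real.norm_of_nonneg hs.1]
    exact mul_le_of_le_one_left dist_nonneg hs.2
  refine LipschitzWith.of_dist_le_mul fun x y => ?_
  by_cases hx : ‖x‖ ≤ ρ <;> by_cases hy : ‖y‖ ≤ ρ
  · simpa [indicator, hx, hy] using hh.dist_le_mul x (by simpa using hx) y (by simpa using hy)
  · simpa [indicator, hx, hy] using aux x y hx (not_le.1 hy)
  · simpa [indicator, hx, hy, dist_comm] using aux y x hy (not_le.1 hx)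
  · simp [indicator, hx, hy]
    positivity

theorem not_exists_contDiff_retraction_sphere {V : Type*} [NormedAddCommGroup V]
    [InnerProductSpace ℝ V] [FiniteDimensional ℝ V] {r : V → V} {ρ : ℝ} (hρ : 0 < ρ)
    (hr : ContDiff ℝ 1 r) (hnorm : ∀ x, ‖r x‖ = ρ) (hfix : ∀ x, ‖x‖ = ρ → r x = x) : False := by
  borelize V
  let μ : Measure V := Measure.addHaar
  let B : Set V := Metric.closedBall 0 ρ
  have hBc : IsCompact B := isCompact_closedBall 0 ρ
  let A : V → V →L[ℝ] V := fun x => fderiv ℝ r x - 1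
  have hA : Continuous A := (hr.continuous_fderiv one_ne_zero).sub continuous_const
  have hder : ∀ x, HasFDerivAt (fun x => r x - x) (A x) x := fun x =>
    ((hr.differentiable one_ne_zero) x).hasFDerivAt.sub (hasFDerivAt_id x)
  have hdet0 : ∀ x, (1 + (1 : ℝ) • A x).det = 0 := by
    intro x
    have e : 1 + (1 : ℝ) • A x = fderiv ℝ r x := by simp [A]
    rw [e]
    by_contra hne
    have hsurj : Function.Surjective (fderiv ℝ r x) := by
      have hu : IsUnit (fderiv ℝ r x : V →ₗ[ℝ] V).det := isUnit_iff_ne_zero.2 hne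
      exact (LinearEquiv.ofIsUnitDet (f := (fderiv ℝ r x : V →ₗ[ℝ] V))
        (v := Module.finBasis ℝ V) (v' := Module.finBasis ℝ V)
        (by simpa using hu)).surjective
    obtain ⟨v, hv⟩ := hsurj (r x)
    have h1 : HasFDerivAt (fun y => ‖r y‖ ^ 2) (2 • (innerSL ℝ (r x)).comp (fderiv ℝ r x)) x :=
      ((hr.differentiable one_ne_zero) x).hasFDerivAt.norm_sq
    have h2 : HasFDerivAt (fun y => ‖r y‖ ^ 2) (0 : V →L[ℝ] ℝ) x := by
      simp only [hnorm]
      exact hasFDerivAt_const _ _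
    have h3 := congrArg (fun T : V →L[ℝ] ℝ => T v) (h1.unique h2)
    simp [hv, hnorm] at h3
    exact hρ.ne' h3
  obtain ⟨C, hC⟩ := hBc.exists_bound_of_continuousOn hA.continuousOn
  let L : NNReal := C.toNNReal
  have hAL : ∀ x ∈ B, ‖A x‖ ≤ L := fun x hx => (hC x hx).trans (Real.le_coe_toNNReal C)
  have hlip : LipschitzOnWith L (fun x => r x - x) B :=
    (convex_closedBall 0 ρ).lipschitzOnWith_of_nnnorm_hasFDerivWithin_le
      (fun x _ => (hder x).hasFDerivWithinAt) (fun x hx => hAL x hx)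
  have hlip' := lipschitzWith_indicator_closedBall hlip (fun x hx => by simp [hfix x hx])
  obtain ⟨ε, hε, hpos⟩ : ∃ ε > 0, ∀ M : V →L[ℝ] V, ‖M‖ < ε → 0 < (1 + M).det := by
    have hcont : Continuous fun M : V →L[ℝ] V => (1 + M).det :=
      ContinuousLinearMap.continuous_det.comp (continuous_const.add continuous_id)
    have h1 : (0:ℝ) < (1 + (0 : V →L[ℝ] V)).det := by
      simp [ContinuousLinearMap.det]
    obtain ⟨ε, hε, h⟩ := Metric.eventually_nhds_iff.1
      (hcont.continuousAt.eventually (lt_mem_nhds h1))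
    exact ⟨ε, hε, fun M hM => h (by simpa using hM)⟩
  have hL1 : (0 : ℝ) < L + 1 := by positivity
  have hcontdet : ∀ t : ℝ, Continuous fun x => (1 + t • A x).det := fun t =>
    ContinuousLinearMap.continuous_det.comp (continuous_const.add (hA.const_smul t))
  have hvol : ∀ t : ℝ, 0 < t → t < min 1 ε / (L + 1) →
      ∫ x in B, (1 + t • A x).det ∂μ = μ.real B := by
    intro t ht0 ht
    rw [lt_div_iff₀ hL1] at ht
    have htL : t * L < min 1 ε := by nlinarith
    let F : V → V := fun x => x + t • B.indicator (fun x => r x - x) x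
    have hF : Function.Bijective F := bijective_add_of_lipschitz hlip' (by
      rw [← NNReal.coe_lt_coe]
      push_cast
      rw [Real.norm_of_nonneg ht0.le]
      exact htL.trans_le (min_le_left _ _))
    have hFout : ∀ x, x ∉ B → F x = x := fun x hx => by simp [F, hx]
    have himg : F '' B = B := by
      ext y
      constructor
      · rintro ⟨x, hx, rfl⟩
        by_contra hn
        exact hn (by rwa [hF.1 (hFout _ hn)])
      · intro hy
        obtain ⟨x, rfl⟩ := hF.2 y
        by_contra hn
        refine hn ⟨x, ?_, rfl⟩
        by_contra hx
        exact hx (by rwa [hFout x hx] at hy)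
    have hdetpos : ∀ x ∈ B, 0 < (1 + t • A x).det := fun x hx => hpos _ (by
      rw [norm_smul, Real.norm_of_nonneg ht0.le]
      exact (mul_le_mul_of_nonneg_left (hAL x hx) ht0.le).trans_lt
        (htL.trans_le (min_le_right _ _)))
    have hFder : ∀ x ∈ B, HasFDerivWithinAt F (1 + t • A x) B x := fun x hx =>
      (((hasFDerivAt_id x).add ((hder x).const_smul t)).hasFDerivWithinAt).congr
        (fun y hy => by simp [F, hy]) (by simp [F, hx])
    have hlin := lintegral_abs_det_fderiv_eq_addHaar_image μ hBc.measurableSet hFder hF.1.injOn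
    rw [himg] at hlin
    rw [integral_eq_lintegral_of_nonneg_ae
      ((ae_restrict_iff' hBc.measurableSet).2 (ae_of_all _ fun x hx => (hdetpos x hx).le))
      (hcontdet t).aestronglyMeasurable, Measure.real, ← hlin]
    congr 1
    exact setLIntegral_congr_fun hBc.measurableSet fun x hx => by
      simp only [abs_of_pos (hdetpos x hx)]
  obtain ⟨v, w, hv, hw, hvw⟩ := exists_extrapolation_weights (Module.finrank ℝ V)
    (show 0 < min 1 ε / ((L : ℝ) + 1) by positivity)
  have hsum : ∀ x, (0 : ℝ) = ∑ i, w i * (1 + v i • A x).det := by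
    intro x
    obtain ⟨q, hq, hqe⟩ := exists_polynomial_det_one_add_smul (A x)
    have h := hvw q hq
    rw [hqe, hdet0] at h
    simpa [hqe] using h
  have hInt : (0 : ℝ) = μ.real B := by
    calc (0 : ℝ) = ∫ x in B, ∑ i, w i * (1 + v i • A x).det ∂μ := by simp [← hsum]
      _ = ∑ i, w i * ∫ x in B, (1 + v i • A x).det ∂μ := by
        rw [integral_finsetSum]
        · simp [integral_const_mul]
        · exact fun i _ => ((hcontdet (v i)).const_smul (w i)).continuousOn.integrableOn_compact hBc
      _ = μ.real B := by
        simp [hvol _ (hv _).1 (hv _).2, ← Finset.sum_mul, hw]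
  have : 0 < μ.real B := by
    refine ENNReal.toReal_pos (Metric.measure_closedBall_pos μ 0 hρ).ne' hBc.measure_lt_top.ne
  exact this.ne hInt

/-- **Brouwer's fixed point theorem** for the closed unit ball. -/
theorem exists_fixedPoint_closedBall {V : Type*} [NormedAddCommGroup V]
    [InnerProductSpace ℝ V] [FiniteDimensional ℝ V] {f : V → V}
    (hf : ContinuousOn f (Metric.closedBall 0 1))
    (hmaps : MapsTo f (Metric.closedBall 0 1) (Metric.closedBall 0 1)) :
    ∃ x ∈ Metric.closedBall (0 : V) 1, f x = x := by
  by_contra! hne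
  let π : V → V := fun x => (max 1 ‖x‖)⁻¹ • x
  have hmax : ∀ x : V, 0 < max 1 ‖x‖ := fun x => lt_max_of_lt_left one_pos
  have hπc : Continuous π :=
    ((continuous_const.max continuous_norm).inv₀ fun x => (hmax x).ne').smul continuous_id
  have hπ : ∀ x, π x ∈ Metric.closedBall (0 : V) 1 := fun x => by
    rw [mem_closedBall_zero_iff, norm_smul, norm_inv, Real.norm_of_nonneg (hmax x).le,
      inv_mul_le_one₀ (hmax x)]
    exact le_max_right _ _
  let c : V → ℝ := fun x => max 0 (min 1 (2 - ‖x‖))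
  have hc : Continuous c := by fun_prop
  let G : V → V := fun x => x - c x • f (π x)
  have hG : Continuous G := continuous_id.sub (hc.smul (hf.comp_continuous hπc hπ))
  have hc0 : ∀ x, 0 ≤ c x := fun x => le_max_left _ _
  have hc1 : ∀ x, c x ≤ 1 := fun x => max_le zero_le_one (min_le_left _ _)
  have hG0 : ∀ x, G x ≠ 0 := by
    intro x hx
    have hx' : x = c x • f (π x) := sub_eq_zero.1 hx
    have hx1 : ‖x‖ ≤ 1 := by
      rw [hx', norm_smul, Real.norm_of_nonneg (hc0 x)]
      exact mul_le_one₀ (hc1 x) (norm_nonneg _) (mem_closedBall_zero_iff.1 (hmaps (hπ x)))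
    have h1 : c x = 1 := by
      simp only [c]
      rw [min_eq_left (by linarith), max_eq_right zero_le_one]
    have h2 : π x = x := by simp [π, max_eq_left hx1]
    rw [h1, h2, one_smul] at hx'
    exact hne x (by simpa using hx1) hx'.symm
  have hGout : ∀ x, 2 ≤ ‖x‖ → G x = x := fun x hx => by
    have : c x = 0 := max_eq_left ((min_le_right _ _).trans (by linarith))
    simp [G, this]
  have hU : {x : V | 2 < ‖x‖} ∈ nhdsSet {x : V | 3 ≤ ‖x‖} :=
    (isOpen_lt continuous_const continuous_norm).mem_nhdsSet.2 fun x (hx : 3 ≤ ‖x‖) => by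
      change 2 < ‖x‖
      linarith
  obtain ⟨g, hg, hgG, hgS, -⟩ := hG.exists_contDiff_approx_and_eqOn 1 hG.norm
    (fun x => norm_pos_iff.2 (hG0 x)) (isClosed_le continuous_const continuous_norm) hU
    (contDiffOn_id.congr fun x (hx : 2 < ‖x‖) => hGout x hx.le)
  have hg0 : ∀ x, g x ≠ 0 := fun x hx => by
    have := hgG x
    simp [hx] at this
  have hgn : ∀ x, ‖g x‖ ≠ 0 := fun x => norm_ne_zero_iff.2 (hg0 x)
  refine not_exists_contDiff_retraction_sphere (r := fun x => (3 * ‖g x‖⁻¹) • g x)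
    (show (0 : ℝ) < 3 by norm_num)
    ((contDiff_const.mul ((hg.norm ℝ hg0).inv hgn)).smul hg) (fun x => ?_) (fun x hx => ?_)
  · rw [norm_smul, norm_mul, norm_inv, norm_norm, mul_assoc, inv_mul_cancel₀ (hgn x)]
    norm_num
  · have : g x = x := (hgS (show 3 ≤ ‖x‖ from hx.ge)).trans (hGout x (by linarith))
    simp [this, hx]

end Brouwer

section Schauder

variable {X : Type*} [NormedAddCommGroup X] [NormedSpace ℝ X]

/-- Brouwer's theorem for maps that factor through a finite convex combination. -/
theorem exists_weights_fixedPoint {ι : Type*} [Fintype ι] [Nonempty ι] {C : Set X}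
    (hC : Convex ℝ C) {y : ι → X} (hy : ∀ i, y i ∈ C) {Ψ : X → ι → ℝ} (hΨ : ContinuousOn Ψ C)
    (hΨ0 : ∀ x ∈ C, ∀ i, 0 ≤ Ψ x i) (hΨ1 : ∀ x ∈ C, ∑ i, Ψ x i = 1) :
    ∃ x ∈ C, x = ∑ i, Ψ x i • y i := by
  let d : EuclideanSpace ℝ ι → ι → ℝ := fun w i => max (w i) 0 + max (1 - ∑ j, max (w j) 0) 0
  have hd0 : ∀ w i, 0 ≤ d w i := fun w i => add_nonneg (le_max_right _ _) (le_max_right _ _)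
  have hdc : ∀ i, Continuous fun w => d w i := fun i => by fun_prop
  have hdpos : ∀ w, 0 < ∑ i, d w i := fun w => by
    by_contra! h
    have h0 : ∀ i, d w i = 0 := fun i =>
      (Finset.sum_eq_zero_iff_of_nonneg fun i _ => hd0 w i).1
        (le_antisymm h (Finset.sum_nonneg fun i _ => hd0 w i)) i (Finset.mem_univ i)
    have h1 : ∀ i, max (w i) 0 = 0 := fun i => by
      have := h0 i
      have h2 := le_max_right (w i) 0
      have h3 := le_max_right (1 - ∑ j, max (w j) 0) 0
      simp only [d] at this
      linarith
    have := h0 (Classical.arbitrary ι)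
    simp [d, h1] at this
  let Φ : EuclideanSpace ℝ ι → X := fun w => Finset.univ.centerMass (d w) y
  have hΦC : ∀ w, Φ w ∈ C := fun w =>
    hC.centerMass_mem (fun i _ => hd0 w i) (hdpos w) (fun i _ => hy i)
  have hΦ : Continuous Φ :=
    ((continuous_finsetSum _ fun i _ => hdc i).inv₀ fun w => (hdpos w).ne').smul
      (continuous_finsetSum _ fun i _ => (hdc i).smul continuous_const)
  obtain ⟨w, -, hw⟩ := exists_fixedPoint_closedBall (f := fun w => WithLp.toLp 2 (Ψ (Φ w)))
    ((PiLp.continuous_toLp 2 _).comp (hΨ.comp_continuous hΦ hΦC)).continuousOn (fun w _ => by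
      rw [mem_closedBall_zero_iff, EuclideanSpace.norm_eq, Real.sqrt_le_one]
      rw [← hΨ1 _ (hΦC w)]
      refine Finset.sum_le_sum fun i _ => ?_
      have h0 := hΨ0 _ (hΦC w) i
      have h1 : Ψ (Φ w) i ≤ 1 := (hΨ1 _ (hΦC w)) ▸
        Finset.single_le_sum (fun j _ => hΨ0 _ (hΦC w) j) (Finset.mem_univ i)
      simp only [Real.norm_eq_abs, sq_abs]
      nlinarith)
  have hwi : ∀ i, w i = Ψ (Φ w) i := fun i => by
    conv_lhs => rw [← hw]
  have hw0 : ∀ i, max (w i) 0 = w i := fun i => max_eq_left (by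
    rw [hwi]
    exact hΨ0 _ (hΦC w) i)
  have hw1 : ∑ i, w i = 1 := by simp only [hwi, hΨ1 _ (hΦC w)]
  have hdw : d w = fun i => Ψ (Φ w) i := by
    ext i
    rw [← hwi]
    simp only [d, hw0, hw1, sub_self, max_self, add_zero]
  refine ⟨Φ w, hΦC w, ?_⟩
  have hΦw : Φ w = Finset.univ.centerMass (fun i => Ψ (Φ w) i) y := by
    change Finset.univ.centerMass (d w) y = _
    rw [hdw]
  rwa [Finset.centerMass_eq_of_sum_1 _ _ (hΨ1 _ (hΦC w))] at hΦw

theorem exists_approx_fixedPoint {C : Set X} (hC : Convex ℝ C) (hne : C.Nonempty) {T : X → X}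
    (hT : ContinuousOn T C) (hTC : MapsTo T C C) {K : Set X} (hK : IsCompact K)
    (hTK : MapsTo T C K) {ε : ℝ} (hε : 0 < ε) : ∃ x ∈ C, dist (T x) x ≤ ε := by
  have htb : TotallyBounded (T '' C) := hK.totallyBounded.subset hTK.image_subset
  obtain ⟨s, hsT, hsf, hs⟩ := totallyBounded_iff_subset.1 htb _ (Metric.dist_mem_uniformity hε)
  have hcov : ∀ x ∈ C, ∃ i : s, dist (T x) i < ε := fun x hx => by
    have := hs (mem_image_of_mem T hx)
    simp only [mem_iUnion] at this
    obtain ⟨i, hi, h⟩ := this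
    exact ⟨⟨i, hi⟩, h⟩
  have : Fintype s := hsf.fintype
  have : Nonempty s := let ⟨x, hx⟩ := hne; let ⟨i, _⟩ := hcov x hx; ⟨i⟩
  let β : s → X → ℝ := fun i x => max (ε - dist (T x) i) 0
  have hβ0 : ∀ i x, 0 ≤ β i x := fun i x => le_max_right _ _
  have hβpos : ∀ x ∈ C, 0 < ∑ i, β i x := fun x hx => by
    obtain ⟨i, hi⟩ := hcov x hx
    exact Finset.sum_pos' (fun i _ => hβ0 i x)
      ⟨i, Finset.mem_univ i, lt_max_of_lt_left (by linarith)⟩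
  have hβc : ∀ i, ContinuousOn (β i) C := fun i =>
    (by fun_prop : Continuous fun y : X => max (ε - dist y i) 0).comp_continuousOn hT
  obtain ⟨x, hx, hfix⟩ := exists_weights_fixedPoint hC (y := fun i : s => (i : X))
    (Ψ := fun x i => β i x / ∑ j, β j x)
    (fun i => hTC.image_subset (hsT i.2))
    (continuousOn_pi.2 fun i => (hβc i).div (continuousOn_finsetSum _ fun i _ => hβc i)
      fun x hx => (hβpos x hx).ne')
    (fun x hx i => div_nonneg (hβ0 i x) (hβpos x hx).le)
    (fun x hx => by rw [← Finset.sum_div, div_self (hβpos x hx).ne'])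
  refine ⟨x, hx, ?_⟩
  have hsum : ∑ i, β i x / ∑ j, β j x = 1 := by
    rw [← Finset.sum_div, div_self (hβpos x hx).ne']
  have hdiff : x - T x = ∑ i, (β i x / ∑ j, β j x) • ((i : X) - T x) := by
    simp only [smul_sub, Finset.sum_sub_distrib]
    rw [← Finset.sum_smul, hsum, one_smul, ← hfix]
  rw [dist_comm, dist_eq_norm, hdiff]
  calc _ ≤ ∑ i, ‖(β i x / ∑ j, β j x) • ((i : X) - T x)‖ := norm_sum_le _ _
    _ ≤ ∑ i, (β i x / ∑ j, β j x) * ε := by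
      refine Finset.sum_le_sum fun i _ => ?_
      have hq : 0 ≤ β i x / ∑ j, β j x := div_nonneg (hβ0 i x) (hβpos x hx).le
      rw [norm_smul, Real.norm_of_nonneg hq]
      by_cases hi : dist (T x) i ≤ ε
      · gcongr
        rwa [← dist_eq_norm, dist_comm]
      · have : β i x = 0 := max_eq_right (by linarith)
        simp [this]
    _ = ε := by rw [← Finset.sum_mul, hsum, one_mul]

/-- **Schauder's fixed point theorem**. -/
theorem exists_fixedPoint_of_mapsTo_compact {C : Set X} (hC : Convex ℝ C) (hcl : IsClosed C)
    (hne : C.Nonempty) {T : X → X} (hT : ContinuousOn T C) (hTC : MapsTo T C C) {K : Set X}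
    (hK : IsCompact K) (hTK : MapsTo T C K) : ∃ x ∈ C, T x = x := by
  choose u huC hu using fun n : ℕ => exists_approx_fixedPoint hC hne hT hTC hK hTK
    (Nat.one_div_pos_of_nat (α := ℝ) (n := n))
  obtain ⟨y, -, φ, hφ, hlim⟩ := hK.tendsto_subseq fun n => hTK (huC n)
  have h0 : Filter.Tendsto (fun n => dist (u (φ n)) (T (u (φ n)))) Filter.atTop (nhds 0) :=
    squeeze_zero (fun _ => dist_nonneg) (fun n => by rw [dist_comm]; exact hu (φ n))
      ((tendsto_one_div_add_atTop_nhds_zero_nat (𝕜 := ℝ)).comp hφ.tendsto_atTop)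
  have hulim : Filter.Tendsto (fun n => u (φ n)) Filter.atTop (nhds y) :=
    (tendsto_iff_of_dist h0).2 hlim
  have hy : y ∈ C := hcl.mem_of_tendsto hulim (Filter.Eventually.of_forall fun n => huC _)
  refine ⟨y, hy, tendsto_nhds_unique ?_ hlim⟩
  exact (hT y hy).tendsto.comp
    (tendsto_nhdsWithin_iff.2 ⟨hulim, Filter.Eventually.of_forall fun n => huC _⟩)

end Schauder

section KernelOperator

theorem ContinuousMap.isCompact_closure_of_equicontinuous {Y : Type*} [TopologicalSpace Y]
    [CompactSpace Y] {A : Set C(Y, ℝ)} {M : ℝ} (hM : ∀ g ∈ A, ∀ t, |g t| ≤ M)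
    (hA : Equicontinuous fun g : A => ((g : C(Y, ℝ)) : Y → ℝ)) : IsCompact (closure A) := by
  let e := (ContinuousMap.isometryEquivBoundedOfCompact Y ℝ).toHomeomorph
  have h : IsCompact (closure (e '' A)) := by
    refine BoundedContinuousFunction.arzela_ascoli (Icc (-M) M) isCompact_Icc _ ?_ ?_
    · rintro _ t ⟨g, hg, rfl⟩
      exact abs_le.1 (hM g hg t)
    · intro t U hU
      filter_upwards [hA t U hU] with x hx
      rintro ⟨_, g, hg, rfl⟩
      exact hx ⟨g, hg⟩
  rw [← e.image_closure] at h
  exact e.isCompact_image.1 h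

theorem ext01_apply (g : C(I01, ℝ)) (t : I01) : ext01 g (t : ℝ) = g t := by
  simp [ext01]

theorem continuous_ext01 (g : C(I01, ℝ)) : Continuous (ext01 g) :=
  g.continuous.Icc_extend'

theorem abs_ext01_le (g : C(I01, ℝ)) (s : ℝ) : |ext01 g s| ≤ ‖g‖ :=
  g.norm_coe_le_norm _

variable {κ : I01 → ℝ → ℝ} {Φ : ℝ → ℝ}

theorem integrable_kernel_mul (hm : ∀ t, AEStronglyMeasurable (κ t) (volume.restrict I01))
    (hΦ : IntegrableOn Φ I01) (hb : ∀ᵐ s ∂(volume.restrict I01), ∀ t, |κ t s| ≤ Φ s)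
    (g : C(I01, ℝ)) (t : I01) : IntegrableOn (fun s => κ t s * ext01 g s) I01 := by
  refine Integrable.mono' (hΦ.mul_const ‖g‖)
    ((hm t).mul (continuous_ext01 g).aestronglyMeasurable) ?_
  filter_upwards [hb] with s hs
  rw [norm_mul]
  exact mul_le_mul (hs t) (abs_ext01_le g s) (abs_nonneg _) ((abs_nonneg _).trans (hs t))

theorem integrable_kernel (hm : ∀ t, AEStronglyMeasurable (κ t) (volume.restrict I01))
    (hΦ : IntegrableOn Φ I01) (hb : ∀ᵐ s ∂(volume.restrict I01), ∀ t, |κ t s| ≤ Φ s)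
    (t : I01) : IntegrableOn (κ t) I01 :=
  Integrable.mono' hΦ (hm t) (hb.mono fun _ hs => hs t)

theorem tendsto_integral_abs_kernel_sub
    (hm : ∀ t, AEStronglyMeasurable (κ t) (volume.restrict I01))
    (hc : ∀ᵐ s ∂(volume.restrict I01), Continuous fun t => κ t s)
    (hΦ : IntegrableOn Φ I01) (hb : ∀ᵐ s ∂(volume.restrict I01), ∀ t, |κ t s| ≤ Φ s) (t₀ : I01) :
    Filter.Tendsto (fun t => ∫ s in I01, |κ t s - κ t₀ s|) (nhds t₀) (nhds 0) := by
  have : (0 : ℝ) = ∫ s in I01, (0 : ℝ) := by simp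
  rw [this]
  refine tendsto_integral_filter_of_dominated_convergence (fun s => Φ s + Φ s)
    (Filter.Eventually.of_forall fun t => ((hm t).sub (hm t₀)).norm)
    (Filter.Eventually.of_forall fun t => ?_) (hΦ.add hΦ) ?_
  · filter_upwards [hb] with s hs
    rw [Real.norm_eq_abs, abs_abs]
    exact (abs_sub _ _).trans (add_le_add (hs t) (hs t₀))
  · filter_upwards [hc] with s hs
    have := ((hs.sub (continuous_const (y := κ t₀ s))).abs).tendsto t₀
    simpa using this

theorem abs_integral_kernel_sub_le
    (hm : ∀ t, AEStronglyMeasurable (κ t) (volume.restrict I01))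
    (hΦ : IntegrableOn Φ I01) (hb : ∀ᵐ s ∂(volume.restrict I01), ∀ t, |κ t s| ≤ Φ s)
    (g : C(I01, ℝ)) (t t₀ : I01) :
    |(∫ s in I01, κ t s * ext01 g s) - ∫ s in I01, κ t₀ s * ext01 g s| ≤
      ‖g‖ * ∫ s in I01, |κ t s - κ t₀ s| := by
  rw [← integral_sub (integrable_kernel_mul hm hΦ hb g t) (integrable_kernel_mul hm hΦ hb g t₀),
    ← integral_const_mul]
  refine (Real.norm_eq_abs _).symm.trans_le <| norm_integral_le_of_norm_le
    (((integrable_kernel hm hΦ hb t).sub (integrable_kernel hm hΦ hb t₀)).abs.const_mul _)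
    (Filter.Eventually.of_forall fun s => ?_)
  rw [← sub_mul, norm_mul, mul_comm]
  exact mul_le_mul_of_nonneg_right (abs_ext01_le g s) (abs_nonneg _)

/-- A linear integral operator with a dominated, continuous kernel is compact on `C[0,1]`. -/
theorem exists_compact_integral_operator
    (hm : ∀ t, AEStronglyMeasurable (κ t) (volume.restrict I01))
    (hc : ∀ᵐ s ∂(volume.restrict I01), Continuous fun t => κ t s)
    (hΦ : IntegrableOn Φ I01) (hb : ∀ᵐ s ∂(volume.restrict I01), ∀ t, |κ t s| ≤ Φ s) :
    ∃ L : C(I01, ℝ) →L[ℝ] C(I01, ℝ), IsCompactOperator L ∧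
      ∀ g t, L g t = ∫ s in I01, κ t s * ext01 g s := by
  have hω := tendsto_integral_abs_kernel_sub hm hc hΦ hb
  have hcont : ∀ g : C(I01, ℝ), Continuous fun t => ∫ s in I01, κ t s * ext01 g s := by
    intro g
    refine continuous_iff_continuousAt.2 fun t₀ => tendsto_iff_dist_tendsto_zero.2 ?_
    refine squeeze_zero (fun _ => dist_nonneg)
      (fun t => abs_integral_kernel_sub_le hm hΦ hb g t t₀) ?_
    simpa using (hω t₀).const_mul ‖g‖
  have hle : ∀ (g : C(I01, ℝ)) (t : I01),
      |∫ s in I01, κ t s * ext01 g s| ≤ (∫ s in I01, Φ s) * ‖g‖ := by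
    intro g t
    rw [← integral_mul_const]
    refine (Real.norm_eq_abs _).symm.trans_le <| norm_integral_le_of_norm_le (hΦ.mul_const _) ?_
    filter_upwards [hb] with s hs
    rw [norm_mul]
    exact mul_le_mul (hs t) (abs_ext01_le g s) (abs_nonneg _) ((abs_nonneg _).trans (hs t))
  have hΦ0 : 0 ≤ ∫ s in I01, Φ s :=
    integral_nonneg_of_ae (hb.mono fun s hs => (abs_nonneg _).trans (hs 0))
  let L₀ : C(I01, ℝ) →ₗ[ℝ] C(I01, ℝ) :=
    { toFun := fun g => ⟨fun t => ∫ s in I01, κ t s * ext01 g s, hcont g⟩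
      map_add' := fun g g' => by
        ext t
        have := integral_add (integrable_kernel_mul hm hΦ hb g t)
          (integrable_kernel_mul hm hΦ hb g' t)
        simpa [ext01, IccExtend, mul_add] using this
      map_smul' := fun c g => by
        ext t
        have := integral_const_mul (μ := volume.restrict I01) c fun s => κ t s * ext01 g s
        simpa [ext01, IccExtend, mul_left_comm] using this }
  let L : C(I01, ℝ) →L[ℝ] C(I01, ℝ) := L₀.mkContinuous (∫ s in I01, Φ s) fun g =>
    (ContinuousMap.norm_le _ (mul_nonneg hΦ0 (norm_nonneg g))).2 fun t => hle g t
  have hL : ∀ g t, L g t = ∫ s in I01, κ t s * ext01 g s := fun g t => rfl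
  refine ⟨L, ?_, hL⟩
  refine (isCompactOperator_iff_isCompact_closure_image_closedBall
    (L : C(I01, ℝ) →ₗ[ℝ] C(I01, ℝ)) one_pos).2 ?_
  refine ContinuousMap.isCompact_closure_of_equicontinuous (M := ∫ s in I01, Φ s) ?_ ?_
  · rintro _ ⟨g, hg, rfl⟩ t
    exact (hle g t).trans (mul_le_of_le_one_right hΦ0 (by simpa using hg))
  · intro t₀
    rw [Metric.equicontinuousAt_iff]
    intro ε hε
    obtain ⟨δ, hδ, h⟩ := Metric.eventually_nhds_iff.1 ((hω t₀).eventually (gt_mem_nhds hε))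
    refine ⟨δ, hδ, fun t ht => ?_⟩
    rintro ⟨_, g, hg, rfl⟩
    have hg' : ‖g‖ ≤ 1 := by simpa using hg
    rw [dist_comm]
    exact ((abs_integral_kernel_sub_le hm hΦ hb g t t₀).trans (mul_le_of_le_one_left
      (integral_nonneg fun _ => abs_nonneg _) hg')).trans_lt (h ht)

theorem integral_kernel_mul_le (hm : ∀ t, AEStronglyMeasurable (κ t) (volume.restrict I01))
    (hΦ : IntegrableOn Φ I01) (hb : ∀ᵐ s ∂(volume.restrict I01), ∀ t, |κ t s| ≤ Φ s)
    (hκ : ∀ᵐ s ∂(volume.restrict I01), ∀ t, 0 ≤ κ t s) {g : C(I01, ℝ)} {M : ℝ}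
    (hg : ∀ s, g s ≤ M) (t : I01) :
    ∫ s in I01, κ t s * ext01 g s ≤ M * ∫ s in I01, κ t s := by
  rw [← integral_const_mul]
  refine integral_mono_ae (integrable_kernel_mul hm hΦ hb g t)
    ((integrable_kernel hm hΦ hb t).const_mul M) (hκ.mono fun s hs => ?_)
  dsimp only
  rw [mul_comm M]
  exact mul_le_mul_of_nonneg_left (hg _) (hs t)

theorem le_integral_kernel_mul (hm : ∀ t, AEStronglyMeasurable (κ t) (volume.restrict I01))
    (hΦ : IntegrableOn Φ I01) (hb : ∀ᵐ s ∂(volume.restrict I01), ∀ t, |κ t s| ≤ Φ s)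
    (hκ : ∀ᵐ s ∂(volume.restrict I01), ∀ t, 0 ≤ κ t s) {g : C(I01, ℝ)} {M : ℝ}
    (hg : ∀ s, M ≤ g s) (t : I01) :
    M * ∫ s in I01, κ t s ≤ ∫ s in I01, κ t s * ext01 g s := by
  rw [← integral_const_mul]
  refine integral_mono_ae ((integrable_kernel hm hΦ hb t).const_mul M)
    (integrable_kernel_mul hm hΦ hb g t) (hκ.mono fun s hs => ?_)
  dsimp only
  rw [mul_comm M]
  exact mul_le_mul_of_nonneg_left (hg _) (hs t)

theorem aestronglyMeasurable_of_hasDerivWithinAt {k kt : ℝ → ℝ → ℝ}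
    (hk : ∀ t, Measurable (k t)) {t : ℝ} (ht : t ∈ I01)
    (h : ∀ᵐ s ∂(volume.restrict I01), HasDerivWithinAt (fun x => k x s) (kt t s) I01 t) :
    AEStronglyMeasurable (kt t) (volume.restrict I01) := by
  have : (nhdsWithin t (I01 \ {t})).NeBot :=
    accPt_principal_iff_nhdsWithin.1 (uniqueDiffOn_Icc zero_lt_one t ht).accPt
  refine aestronglyMeasurable_of_tendsto_ae (nhdsWithin t (I01 \ {t}))
    (f := fun x s => slope (fun x => k x s) t x) (fun x => ?_)
    (h.mono fun s hs => hasDerivWithinAt_iff_tendsto_slope.1 hs)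
  simp only [slope_def_field]
  exact (((hk x).sub (hk t)).div_const _).aestronglyMeasurable

theorem hasDerivWithinAt_integral_kernel {k kt : ℝ → ℝ → ℝ} {Φ Ψ : ℝ → ℝ}
    (hk : ∀ t, Measurable (k t)) (hΦ : IntegrableOn Φ I01) (hΨ : IntegrableOn Ψ I01)
    (hb : ∀ᵐ s ∂(volume.restrict I01), ∀ t : I01, |k t s| ≤ Φ s)
    (hkt : ∀ᵐ s ∂(volume.restrict I01), ∀ t ∈ I01,
      HasDerivWithinAt (fun x => k x s) (kt t s) I01 t ∧ |kt t s| ≤ Ψ s)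
    (g : C(I01, ℝ)) {t : ℝ} (ht : t ∈ I01) :
    HasDerivWithinAt (fun t => ∫ s in I01, k t s * ext01 g s)
      (∫ s in I01, kt t s * ext01 g s) I01 t := by
  rw [hasDerivWithinAt_iff_tendsto_slope]
  have hInt : ∀ x ∈ I01, IntegrableOn (fun s => k x s * ext01 g s) I01 := fun x hx =>
    integrable_kernel_mul (κ := fun t s => k t s) (fun t => (hk t).aestronglyMeasurable) hΦ hb g
      ⟨x, hx⟩
  have hev : ∀ᶠ x in nhdsWithin t (I01 \ {t}), x ∈ I01 \ {t} := self_mem_nhdsWithin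
  have heq : (fun x => ∫ s in I01, slope (fun x => k x s) t x * ext01 g s)
      =ᶠ[nhdsWithin t (I01 \ {t})] slope (fun t => ∫ s in I01, k t s * ext01 g s) t := by
    filter_upwards [hev] with x hx
    rw [slope_def_field, ← integral_sub (hInt x hx.1) (hInt t ht), ← integral_div]
    congr 1
    ext s
    rw [slope_def_field]
    ring
  refine Filter.Tendsto.congr' heq ?_
  refine tendsto_integral_filter_of_dominated_convergence (fun s => Ψ s * ‖g‖)
    (Filter.Eventually.of_forall fun x => ?_) ?_ (hΨ.mul_const _) ?_
  · simp only [slope_def_field]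
    exact ((((hk x).sub (hk t)).div_const _).mul
      (continuous_ext01 g).measurable).aestronglyMeasurable
  · filter_upwards [hev] with x hx
    filter_upwards [hkt] with s hs
    have hΨs : 0 ≤ Ψ s := (abs_nonneg _).trans (hs t ht).2
    have h1 := (convex_Icc (0:ℝ) 1).norm_image_sub_le_of_norm_hasDerivWithin_le
      (fun y hy => (hs y hy).1) (fun y hy => (hs y hy).2) ht hx.1
    have hne : 0 < ‖x - t‖ := norm_pos_iff.2 (sub_ne_zero.2 hx.2)
    rw [norm_mul, slope_def_field, norm_div]
    exact mul_le_mul ((div_le_iff₀ hne).2 h1) (abs_ext01_le g s) (abs_nonneg _) hΨs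
  · filter_upwards [hkt] with s hs
    exact (hasDerivWithinAt_iff_tendsto_slope.1 (hs t ht).1).mul_const _

end KernelOperator

/-! Fixed points in cones -/

/-- A compact self-map of a closed cone that does not increase the norm on the sphere of radius
`R` has a fixed point in the closed ball of radius `R`. -/
theorem exists_fixedPoint_of_norm_le_on_sphere {X : Type*} [NormedAddCommGroup X]
    [NormedSpace ℝ X] {P : Set X} (hP : Convex ℝ P) (hcl : IsClosed P) (h0 : (0 : X) ∈ P)
    (hsmul : ∀ c : ℝ, 0 ≤ c → ∀ x ∈ P, c • x ∈ P) {R : ℝ} (hR : 0 < R) {T : X → X}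
    (hT : ContinuousOn T P) (hTP : MapsTo T P P) {K : Set X} (hK : IsCompact K)
    (hTK : MapsTo T (P ∩ Metric.closedBall 0 R) K)
    (hbd : ∀ x ∈ P, ‖x‖ = R → ‖T x‖ ≤ R) : ∃ x ∈ P, ‖x‖ ≤ R ∧ T x = x := by
  let q : X → X := fun x => (R / max R ‖x‖) • x
  have hmax : ∀ x : X, 0 < max R ‖x‖ := fun x => lt_max_of_lt_left hR
  have hq : Continuous q := by
    refine Continuous.smul (Continuous.div continuous_const (by fun_prop) fun x => ?_) continuous_id
    exact (hmax x).ne'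
  have hqn : ∀ x, ‖q x‖ = R / max R ‖x‖ * ‖x‖ := fun x => by
    rw [norm_smul, Real.norm_of_nonneg (div_nonneg hR.le (hmax x).le)]
  obtain ⟨x, ⟨hxP, hxR⟩, hx⟩ := exists_fixedPoint_of_mapsTo_compact
    (C := P ∩ Metric.closedBall 0 R) (T := q ∘ T) (K := q '' K)
    (hP.inter (convex_closedBall 0 R)) (hcl.inter Metric.isClosed_closedBall)
    ⟨0, h0, by simpa using hR.le⟩ (hq.comp_continuousOn (hT.mono inter_subset_left))
    (fun x hx => ⟨hsmul _ (div_nonneg hR.le (hmax _).le) _ (hTP hx.1), by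
      rw [mem_closedBall_zero_iff, Function.comp_apply, hqn, div_mul_eq_mul_div,
        div_le_iff₀ (hmax _)]
      exact mul_le_mul_of_nonneg_left (le_max_right _ _) hR.le⟩)
    (hK.image hq) (fun x hx => mem_image_of_mem q (hTK hx))
  have hxR' : ‖x‖ ≤ R := by simpa using hxR
  have hTx : ‖T x‖ ≤ R := by
    by_contra! h
    refine absurd (hbd x hxP ?_) h.not_ge
    rw [← hx, Function.comp_apply, hqn, max_eq_right h.le, div_mul_cancel₀ _ (hR.trans h).ne']
  refine ⟨x, hxP, hxR', ?_⟩
  rw [Function.comp_apply] at hx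
  simpa [q, max_eq_left hTx, div_self hR.ne'] using hx

/-! The cone of nondecreasing functions -/

theorem isC1_iff {p : E} :
    IsC1 p ↔ ∀ t : I01, p.1 t = p.1 0 + ∫ s in (0:ℝ)..t, ext01 p.2 s := by
  constructor
  · intro h t
    have := intervalIntegral.integral_eq_sub_of_hasDerivAt_of_le t.2.1
      (continuous_ext01 p.1).continuousOn (f' := ext01 p.2) (fun x hx => by
        have hx' : x ∈ I01 := ⟨hx.1.le, hx.2.le.trans t.2.2⟩
        rw [ext01_apply p.2 ⟨x, hx'⟩]
        exact (h ⟨x, hx'⟩).hasDerivAt (Icc_mem_nhds hx.1 (hx.2.trans_le t.2.2)))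
      ((continuous_ext01 p.2).intervalIntegrable _ _)
    rw [this, ext01_apply, show ext01 p.1 0 = p.1 0 from ext01_apply p.1 0]
    ring
  · intro h t
    have := (((continuous_ext01 p.2).integral_hasStrictDerivAt 0 t).hasDerivAt.const_add
      (p.1 0)).hasDerivWithinAt (s := I01)
    rw [ext01_apply] at this
    exact this.congr (fun x hx => (ext01_apply p.1 ⟨x, hx⟩).trans (h ⟨x, hx⟩))
      ((ext01_apply p.1 t).trans (h t))

theorem isClosed_coneP : IsClosed coneP := by
  have h1 : IsClosed {p : E | IsC1 p} := by
    simp only [isC1_iff, ofPred_forall]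
    refine isClosed_iInter fun t => isClosed_eq (by fun_prop) (Continuous.add (by fun_prop) ?_)
    refine intervalIntegral.continuous_parametric_intervalIntegral_of_continuous' ?_ _ _
    have : Continuous fun x : E × ℝ => x.1.2 (projIcc 0 1 zero_le_one x.2) := by fun_prop
    exact this
  have h2 : IsClosed {p : E | ∀ t : I01, 0 ≤ p.1 t ∧ 0 ≤ p.2 t} := by
    simp only [ofPred_forall]
    refine isClosed_iInter fun t => IsClosed.inter (s₁ := {p : E | 0 ≤ p.1 t})
      (s₂ := {p : E | 0 ≤ p.2 t}) ?_ ?_ <;> exact isClosed_le continuous_const (by fun_prop)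
  exact h1.inter h2

theorem zero_mem_coneP : (0 : E) ∈ coneP :=
  ⟨isC1_iff.2 fun t => by simp [ext01, IccExtend], fun t => by simp⟩

theorem add_mem_coneP {p q : E} (hp : p ∈ coneP) (hq : q ∈ coneP) : p + q ∈ coneP :=
  ⟨fun t => (hp.1 t).add (hq.1 t), fun t =>
    ⟨add_nonneg (hp.2 t).1 (hq.2 t).1, add_nonneg (hp.2 t).2 (hq.2 t).2⟩⟩

theorem smul_mem_coneP {c : ℝ} (hc : 0 ≤ c) {p : E} (hp : p ∈ coneP) : c • p ∈ coneP :=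
  ⟨fun t => (hp.1 t).const_smul c, fun t =>
    ⟨mul_nonneg hc (hp.2 t).1, mul_nonneg hc (hp.2 t).2⟩⟩

theorem convex_coneP : Convex ℝ coneP := fun _ hp _ hq _ _ ha hb _ =>
  add_mem_coneP (smul_mem_coneP ha hp) (smul_mem_coneP hb hq)

theorem le_apply_one_of_mem_coneP {p : E} (hp : p ∈ coneP) (t : I01) : p.1 t ≤ p.1 1 := by
  have h := isC1_iff.1 hp.1
  rw [h t, h 1]
  refine add_le_add_right ?_ _
  rw [← sub_nonneg, intervalIntegral.integral_interval_sub_left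
    ((continuous_ext01 p.2).intervalIntegrable _ _)
    ((continuous_ext01 p.2).intervalIntegrable _ _)]
  exact intervalIntegral.integral_nonneg t.2.2 fun s _ => (hp.2 _).2

theorem norm_le_of_mem_coneP {p : E} (hp : p ∈ coneP) {R : ℝ} (h1 : p.1 1 ≤ R)
    (h2 : ∀ t, p.2 t ≤ R) : ‖p‖ ≤ R := by
  have hR : 0 ≤ R := (hp.2 1).1.trans h1
  refine norm_prod_le_iff.2 ⟨(ContinuousMap.norm_le _ hR).2 fun t => ?_,
    (ContinuousMap.norm_le _ hR).2 fun t => ?_⟩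
  · rw [Real.norm_of_nonneg (hp.2 t).1]
    exact (le_apply_one_of_mem_coneP hp t).trans h1
  · rw [Real.norm_of_nonneg (hp.2 t).2]
    exact h2 t

theorem apply_fst_le_norm (p : E) (t : I01) : p.1 t ≤ ‖p‖ :=
  (le_abs_self _).trans ((p.1.norm_coe_le_norm t).trans (norm_fst_le p))

theorem apply_snd_le_norm (p : E) (t : I01) : p.2 t ≤ ‖p‖ :=
  (le_abs_self _).trans ((p.2.norm_coe_le_norm t).trans (norm_snd_le p))

theorem exists_mem_coneP_of_hasDerivWithinAt {γ γ' : ℝ → ℝ}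
    (hγ : ∀ t ∈ I01, HasDerivWithinAt γ (γ' t) I01 t) (hγ' : ContinuousOn γ' I01)
    (h : ∀ t ∈ I01, 0 ≤ γ t ∧ 0 ≤ γ' t) :
    ∃ G ∈ coneP, ∀ t : I01, G.1 t = γ t ∧ G.2 t = γ' t := by
  have hc : ContinuousOn γ I01 := fun t ht => (hγ t ht).continuousWithinAt
  let G : E := (⟨fun t => γ t, hc.domRestrict⟩, ⟨fun t => γ' t, hγ'.domRestrict⟩)
  exact ⟨G, ⟨fun t => (hγ t t.2).congr (fun x hx => ext01_apply G.1 ⟨x, hx⟩) (ext01_apply G.1 t),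
    fun t => h t t.2⟩, fun t => ⟨rfl, rfl⟩⟩

/-! The superposition operator -/

section Superposition

variable {f : ℝ → ℝ → ℝ → ℝ}

theorem exists_continuous_superposition
    (hf : ContinuousOn (fun x : ℝ × ℝ × ℝ => f x.1 x.2.1 x.2.2)
      (I01 ×ˢ Ici (0:ℝ) ×ˢ Ici (0:ℝ))) :
    ∃ N : E → C(I01, ℝ), Continuous N ∧
      ∀ p s, N p s = f s (max (p.1 s) 0) (max (p.2 s) 0) := by
  let F : C(E × I01, ℝ) :=
    ⟨fun x => f x.2 (max (x.1.1 x.2) 0) (max (x.1.2 x.2) 0),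
      hf.comp_continuous (f := fun x : E × I01 =>
        ((x.2 : ℝ), max (x.1.1 x.2) 0, max (x.1.2 x.2) 0)) (by fun_prop)
        fun x => ⟨x.2.2, mem_Ici.2 (le_max_right _ _), mem_Ici.2 (le_max_right _ _)⟩⟩
  exact ⟨F.curry, F.curry.continuous, fun p s => rfl⟩

theorem isCompact_range_of_continuousOn
    (hf : ContinuousOn (fun x : ℝ × ℝ × ℝ => f x.1 x.2.1 x.2.2)
      (I01 ×ˢ Ici (0:ℝ) ×ˢ Ici (0:ℝ))) (ρ : ℝ) :
    IsCompact (range fun x : I01 × Icc (0:ℝ) ρ × Icc (0:ℝ) ρ =>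
      f (x.1 : ℝ) (x.2.1 : ℝ) (x.2.2 : ℝ)) :=
  isCompact_range (hf.comp_continuous (f := fun x : I01 × Icc (0:ℝ) ρ × Icc (0:ℝ) ρ =>
    ((x.1 : ℝ), (x.2.1 : ℝ), (x.2.2 : ℝ))) (by fun_prop)
    fun x => ⟨x.1.2, x.2.1.2.1, x.2.2.2.1⟩)

theorem apply_le_fSup
    (hf : ContinuousOn (fun x : ℝ × ℝ × ℝ => f x.1 x.2.1 x.2.2)
      (I01 ×ˢ Ici (0:ℝ) ×ˢ Ici (0:ℝ))) {ρ t u v : ℝ} (ht : t ∈ I01) (hu : u ∈ Icc 0 ρ)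
    (hv : v ∈ Icc 0 ρ) : f t u v ≤ fSup f ρ :=
  le_ciSup (isCompact_range_of_continuousOn hf ρ).bddAbove
    ((⟨t, ht⟩, ⟨u, hu⟩, ⟨v, hv⟩) : I01 × Icc (0:ℝ) ρ × Icc (0:ℝ) ρ)

theorem fInf_le_apply
    (hf : ContinuousOn (fun x : ℝ × ℝ × ℝ => f x.1 x.2.1 x.2.2)
      (I01 ×ˢ Ici (0:ℝ) ×ˢ Ici (0:ℝ))) {ρ t u v : ℝ} (ht : t ∈ I01) (hu : u ∈ Icc 0 ρ)
    (hv : v ∈ Icc 0 ρ) : fInf f ρ ≤ f t u v :=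
  ciInf_le (isCompact_range_of_continuousOn hf ρ).bddBelow
    ((⟨t, ht⟩, ⟨u, hu⟩, ⟨v, hv⟩) : I01 × Icc (0:ℝ) ρ × Icc (0:ℝ) ρ)

end Superposition

/-! The Hammerstein operator -/

theorem exists_compact_operator_mapsTo_coneP {k kt : ℝ → ℝ → ℝ} {Φ Ψ : ℝ → ℝ}
    (hk : ∀ t, Measurable (k t))
    (hkc : ∀ᵐ s ∂(volume.restrict I01), Continuous fun t : I01 => k t s)
    (hΦ : IntegrableOn Φ I01)
    (hkb : ∀ᵐ s ∂(volume.restrict I01), ∀ t : I01, |k t s| ≤ Φ s)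
    (hk0 : ∀ᵐ s ∂(volume.restrict I01), ∀ t : I01, 0 ≤ k t s)
    (hkt : ∀ t : I01, AEStronglyMeasurable (kt t) (volume.restrict I01))
    (hktc : ∀ᵐ s ∂(volume.restrict I01), Continuous fun t : I01 => kt t s)
    (hΨ : IntegrableOn Ψ I01)
    (hktb : ∀ᵐ s ∂(volume.restrict I01), ∀ t : I01, |kt t s| ≤ Ψ s)
    (hkt0 : ∀ᵐ s ∂(volume.restrict I01), ∀ t : I01, 0 ≤ kt t s)
    (hderiv : ∀ᵐ s ∂(volume.restrict I01), ∀ t ∈ I01,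
      HasDerivWithinAt (fun x => k x s) (kt t s) I01 t) :
    ∃ L : C(I01, ℝ) →L[ℝ] E, IsCompactOperator L ∧
      (∀ g t, (L g).1 t = ∫ s in I01, k t s * ext01 g s) ∧
      (∀ g t, (L g).2 t = ∫ s in I01, kt t s * ext01 g s) ∧
      ∀ g : C(I01, ℝ), (∀ s, 0 ≤ g s) → L g ∈ coneP := by
  obtain ⟨L, ⟨K, hK, hKn⟩, hL⟩ := exists_compact_integral_operator (κ := fun t s => k t s)
    (fun t => (hk t).aestronglyMeasurable) hkc hΦ hkb
  obtain ⟨L', ⟨K', hK', hKn'⟩, hL'⟩ := exists_compact_integral_operator (κ := fun t s => kt t s)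
    hkt hktc hΨ hktb
  refine ⟨L.prod L', ⟨K ×ˢ K', hK.prod hK', ?_⟩, hL, hL', fun g hg => ⟨fun t => ?_, fun t => ?_⟩⟩
  · filter_upwards [hKn, hKn'] with g h1 h2 using ⟨h1, h2⟩
  · have h := hasDerivWithinAt_integral_kernel hk hΦ hΨ hkb
      (by filter_upwards [hderiv, hktb] with s h1 h2 t ht using ⟨h1 t ht, h2 ⟨t, ht⟩⟩) g t.2
    rw [← hL' g t] at h
    exact h.congr (fun x hx => (ext01_apply _ ⟨x, hx⟩).trans (hL g ⟨x, hx⟩))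
      ((ext01_apply _ t).trans (hL g t))
  · constructor
    · refine (integral_nonneg_of_ae ?_).trans_eq (hL g t).symm
      filter_upwards [hk0] with s hs using mul_nonneg (hs t) (hg _)
    · refine (integral_nonneg_of_ae ?_).trans_eq (hL' g t).symm
      filter_upwards [hkt0] with s hs using mul_nonneg (hs t) (hg _)

theorem le_Hsup {h : E → ℝ} (hh : ∀ B ⊆ coneP, IsBounded B → IsBounded (h '' B)) {p : E}
    (hp : p ∈ coneP) : h p ≤ Hsup h ‖p‖ := by
  refine le_csSup (hh _ (sep_subset _ _) ?_).bddAbove ⟨p, ⟨hp, rfl⟩, rfl⟩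
  exact isBounded_iff_forall_norm_le.2 ⟨‖p‖, fun q hq => hq.2.le⟩

theorem exists_upper_bound_on_ball {h : E → ℝ}
    (hh : ∀ B ⊆ coneP, IsBounded B → IsBounded (h '' B)) (R : ℝ) :
    ∃ M, ∀ p ∈ coneP ∩ Metric.closedBall 0 R, h p ≤ M := by
  obtain ⟨M, hM⟩ := (hh (coneP ∩ Metric.closedBall 0 R) inter_subset_left
    (Metric.isBounded_closedBall.subset inter_subset_right)).bddAbove
  exact ⟨M, fun p hp => hM ⟨p, hp, rfl⟩⟩

theorem le_supNorm {γ : ℝ → ℝ} (hγ : ContinuousOn γ I01) (t : I01) : γ t ≤ supNorm γ :=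
  (le_abs_self _).trans (le_ciSup (f := fun t : I01 => |γ t|)
    (isCompact_range hγ.domRestrict.abs).bddAbove t)

theorem setIntegral_I01_eq (φ : ℝ → ℝ) : ∫ s in I01, φ s = ∫ s in (0:ℝ)..1, φ s := by
  rw [intervalIntegral.integral_of_le zero_le_one, integral_Icc_eq_integral_Ioc]

theorem setIntegral_le_Kstar {kt : ℝ → ℝ → ℝ} {Ψ : ℝ → ℝ} (hΨ : IntegrableOn Ψ I01)
    (hb : ∀ᵐ s ∂(volume.restrict I01), ∀ t : I01, |kt t s| ≤ Ψ s) (t : I01) :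
    ∫ s in I01, kt t s ≤ Kstar kt := by
  rw [setIntegral_I01_eq]
  refine le_ciSup (f := fun t : I01 => ∫ s in (0:ℝ)..1, kt t s) ⟨∫ s in I01, Ψ s, ?_⟩ t
  rintro _ ⟨t, rfl⟩
  dsimp only
  rw [← setIntegral_I01_eq]
  exact (Real.le_norm_self _).trans (norm_integral_le_of_norm_le hΨ (hb.mono fun s hs => hs t))

/-- Theorem 2.2 in the paper: existence of a non-negative, non-decreasing solution of the
perturbed Hammerstein integral equation, localized by `r ≤ ‖u‖ ≤ R`. -/
theorem existence_of_solution
    (k kt : ℝ → ℝ → ℝ) (Φ Ψ : ℝ → ℝ) (f : ℝ → ℝ → ℝ → ℝ)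
    (γ₁ γ₂ γ₁' γ₂' : ℝ → ℝ) (η₁ η₂ lam : ℝ) (h₁ h₂ : E → ℝ)
    -- (C₁)
    (hk_meas : Measurable (Function.uncurry k))
    (hk_cont : ∀ᵐ s ∂(volume.restrict I01), ContinuousOn (fun t => k t s) I01)
    (hk_nonneg : ∀ t ∈ I01, ∀ s ∈ I01, 0 ≤ k t s)
    (hΦ : IntegrableOn Φ I01)
    (hkΦ : ∀ᵐ s ∂(volume.restrict I01), ∀ t ∈ I01, k t s ≤ Φ s)
    -- (C₂)
    (hkt : ∀ᵐ s ∂(volume.restrict I01),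
      (∀ t ∈ I01, HasDerivWithinAt (fun x => k x s) (kt t s) I01 t) ∧
      ContinuousOn (fun t => kt t s) I01 ∧
      ∀ t ∈ I01, 0 ≤ kt t s ∧ kt t s ≤ Ψ s)
    (hΨ : IntegrableOn Ψ I01)
    -- (C₃)
    (hf_cont : ContinuousOn (fun x : ℝ × ℝ × ℝ => f x.1 x.2.1 x.2.2)
      (I01 ×ˢ Ici (0:ℝ) ×ˢ Ici (0:ℝ)))
    (hf_nonneg : ∀ t ∈ I01, ∀ u ∈ Ici (0:ℝ), ∀ v ∈ Ici (0:ℝ), 0 ≤ f t u v)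
    -- (C₄)
    (hγ₁ : ∀ t ∈ I01, HasDerivWithinAt γ₁ (γ₁' t) I01 t)
    (hγ₂ : ∀ t ∈ I01, HasDerivWithinAt γ₂ (γ₂' t) I01 t)
    (hγ₁'c : ContinuousOn γ₁' I01) (hγ₂'c : ContinuousOn γ₂' I01)
    (hγ_nonneg : ∀ t ∈ I01, 0 ≤ γ₁ t ∧ 0 ≤ γ₂ t ∧ 0 ≤ γ₁' t ∧ 0 ≤ γ₂' t)
    -- (C₅)
    (hη₁ : 0 ≤ η₁) (hη₂ : 0 ≤ η₂) (hlam : 0 ≤ lam)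
    -- (C₆)
    (hh₁_nonneg : ∀ p ∈ coneP, 0 ≤ h₁ p) (hh₂_nonneg : ∀ p ∈ coneP, 0 ≤ h₂ p)
    (hh₁_cont : ContinuousOn h₁ coneP) (hh₂_cont : ContinuousOn h₂ coneP)
    (hh₁_bdd : ∀ B ⊆ coneP, IsBounded B → IsBounded (h₁ '' B))
    (hh₂_bdd : ∀ B ⊆ coneP, IsBounded B → IsBounded (h₂ '' B))
    -- the two index conditions
    (r R : ℝ) (hr : 0 < r) (hrR : r < R)
    (hidx1 : max (lam * fSup f R * Kconst k + η₁ * γ₁ 1 * Hsup h₁ R + η₂ * γ₂ 1 * Hsup h₂ R)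
        (lam * fSup f R * Kstar kt + η₁ * supNorm γ₁' * Hsup h₁ R +
          η₂ * supNorm γ₂' * Hsup h₂ R) ≤ R)
    (hidx0 : r ≤ lam * fInf f r * min (Kconst k) (Kstar kt)) :
    ∃ p ∈ coneP, r ≤ ‖p‖ ∧ ‖p‖ ≤ R ∧
      ∀ t : I01, p.1 t = η₁ * γ₁ (t : ℝ) * h₁ p + η₂ * γ₂ (t : ℝ) * h₂ p +
        lam * ∫ s in (0:ℝ)..1, k (t : ℝ) s * f s (ext01 p.1 s) (ext01 p.2 s) := by
  have hkm : ∀ t, Measurable (k t) := fun t => hk_meas.of_uncurry_left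
  have hkc : ∀ᵐ s ∂(volume.restrict I01), Continuous fun t : I01 => k t s :=
    hk_cont.mono fun s hs => hs.domRestrict
  have hk0 : ∀ᵐ s ∂(volume.restrict I01), ∀ t : I01, 0 ≤ k t s :=
    (ae_restrict_mem measurableSet_Icc).mono fun s hs t => hk_nonneg t t.2 s hs
  have hkb : ∀ᵐ s ∂(volume.restrict I01), ∀ t : I01, |k t s| ≤ Φ s := by
    filter_upwards [hk0, hkΦ] with s h1 h2 t
    exact (abs_of_nonneg (h1 t)).trans_le (h2 t t.2)
  have hderiv : ∀ᵐ s ∂(volume.restrict I01), ∀ t ∈ I01,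
      HasDerivWithinAt (fun x => k x s) (kt t s) I01 t := hkt.mono fun s hs => hs.1
  have hktm : ∀ t : I01, AEStronglyMeasurable (kt t) (volume.restrict I01) := fun t =>
    aestronglyMeasurable_of_hasDerivWithinAt hkm t.2 (hderiv.mono fun s hs => hs t t.2)
  have hktc : ∀ᵐ s ∂(volume.restrict I01), Continuous fun t : I01 => kt t s :=
    hkt.mono fun s hs => hs.2.1.domRestrict
  have hkt0 : ∀ᵐ s ∂(volume.restrict I01), ∀ t : I01, 0 ≤ kt t s :=
    hkt.mono fun s hs t => (hs.2.2 t t.2).1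
  have hktb : ∀ᵐ s ∂(volume.restrict I01), ∀ t : I01, |kt t s| ≤ Ψ s :=
    hkt.mono fun s hs t => (abs_of_nonneg (hs.2.2 t t.2).1).trans_le (hs.2.2 t t.2).2
  obtain ⟨L, hLc, hL1, hL2, hLP⟩ := exists_compact_operator_mapsTo_coneP hkm hkc hΦ hkb hk0 hktm
    hktc hΨ hktb hkt0 hderiv
  obtain ⟨N, hN, hNf⟩ := exists_continuous_superposition hf_cont
  obtain ⟨G₁, hG₁, hG₁γ⟩ := exists_mem_coneP_of_hasDerivWithinAt hγ₁ hγ₁'c fun t ht =>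
    ⟨(hγ_nonneg t ht).1, (hγ_nonneg t ht).2.2.1⟩
  obtain ⟨G₂, hG₂, hG₂γ⟩ := exists_mem_coneP_of_hasDerivWithinAt hγ₂ hγ₂'c fun t ht =>
    ⟨(hγ_nonneg t ht).2.1, (hγ_nonneg t ht).2.2.2⟩
  have hR : 0 < R := hr.trans hrR
  have hN0 : ∀ p s, 0 ≤ N p s := fun p s => by
    rw [hNf]
    exact hf_nonneg s s.2 _ (mem_Ici.2 (le_max_right _ _)) _ (mem_Ici.2 (le_max_right _ _))
  have hNcone : ∀ p ∈ coneP, ∀ s, N p s = f s (p.1 s) (p.2 s) := fun p hp s => by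
    rw [hNf, max_eq_left (hp.2 s).1, max_eq_left (hp.2 s).2]
  have hNsup : ∀ p ∈ coneP, ‖p‖ ≤ R → ∀ s, N p s ≤ fSup f R := fun p hp hpR s => by
    rw [hNcone p hp]
    exact apply_le_fSup hf_cont s.2 ⟨(hp.2 s).1, (apply_fst_le_norm p s).trans hpR⟩
      ⟨(hp.2 s).2, (apply_snd_le_norm p s).trans hpR⟩
  have hsup0 : 0 ≤ fSup f R := Real.iSup_nonneg fun x =>
    hf_nonneg _ x.1.2 _ x.2.1.2.1 _ x.2.2.2.1
  have hinf0 : 0 ≤ fInf f r := Real.iInf_nonneg fun x =>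
    hf_nonneg _ x.1.2 _ x.2.1.2.1 _ x.2.2.2.1
  have hNball : ∀ p ∈ coneP ∩ Metric.closedBall 0 R,
      N p ∈ Metric.closedBall (0 : C(I01, ℝ)) (fSup f R) := fun p hp => by
    refine mem_closedBall_zero_iff.2 ((ContinuousMap.norm_le _ hsup0).2 fun s => ?_)
    rw [Real.norm_of_nonneg (hN0 p s)]
    exact hNsup p hp.1 (mem_closedBall_zero_iff.1 hp.2) s
  have hNinf : ∀ p ∈ coneP, ‖p‖ ≤ r → ∀ s, fInf f r ≤ N p s := fun p hp hpr s => by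
    rw [hNcone p hp]
    exact fInf_le_apply hf_cont s.2 ⟨(hp.2 s).1, (apply_fst_le_norm p s).trans hpr⟩
      ⟨(hp.2 s).2, (apply_snd_le_norm p s).trans hpr⟩
  have hK : ∫ s in I01, k (1 : I01) s = Kconst k := setIntegral_I01_eq _
  let T : E → E := fun p => (η₁ * h₁ p) • G₁ + (η₂ * h₂ p) • G₂ + lam • L (N p)
  have hTP : MapsTo T coneP coneP := fun p hp =>
    add_mem_coneP (add_mem_coneP (smul_mem_coneP (mul_nonneg hη₁ (hh₁_nonneg p hp)) hG₁)
      (smul_mem_coneP (mul_nonneg hη₂ (hh₂_nonneg p hp)) hG₂))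
      (smul_mem_coneP hlam (hLP _ (hN0 p)))
  have hTc : ContinuousOn T coneP :=
    (((continuousOn_const.mul hh₁_cont).smul continuousOn_const).add
      ((continuousOn_const.mul hh₂_cont).smul continuousOn_const)).add
      ((L.continuous.comp hN).const_smul lam).continuousOn
  have hT1 : ∀ p t, (T p).1 t = η₁ * h₁ p * γ₁ t + η₂ * h₂ p * γ₂ t +
      lam * ∫ s in I01, k t s * ext01 (N p) s := fun p t => by
    rw [← hL1, ← (hG₁γ t).1, ← (hG₂γ t).1]
    rfl
  have hT2 : ∀ p t, (T p).2 t = η₁ * h₁ p * γ₁' t + η₂ * h₂ p * γ₂' t +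
      lam * ∫ s in I01, kt t s * ext01 (N p) s := fun p t => by
    rw [← hL2, ← (hG₁γ t).2, ← (hG₂γ t).2]
    rfl
  have hTR : ∀ p ∈ coneP, ‖p‖ = R → ‖T p‖ ≤ R := by
    intro p hp hpR
    have hH₁ : h₁ p ≤ Hsup h₁ R := hpR ▸ le_Hsup hh₁_bdd hp
    have hH₂ : h₂ p ≤ Hsup h₂ R := hpR ▸ le_Hsup hh₂_bdd hp
    have hH₁0 := (hh₁_nonneg p hp).trans hH₁
    have hH₂0 := (hh₂_nonneg p hp).trans hH₂
    refine norm_le_of_mem_coneP (hTP hp) ?_ fun t => ?_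
    · refine le_trans ?_ ((le_max_left _ _).trans hidx1)
      have h1 := integral_kernel_mul_le (κ := fun t s => k t s)
        (fun t => (hkm t).aestronglyMeasurable) hΦ hkb hk0 (hNsup p hp hpR.le) 1
      rw [hK] at h1
      have hγ := hγ_nonneg 1 (right_mem_Icc.2 zero_le_one)
      have a1 := mul_le_mul_of_nonneg_left hH₁ (mul_nonneg hη₁ hγ.1)
      have a2 := mul_le_mul_of_nonneg_left hH₂ (mul_nonneg hη₂ hγ.2.1)
      have a3 := mul_le_mul_of_nonneg_left h1 hlam
      rw [hT1, Icc.coe_one]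
      rw [Icc.coe_one] at a3
      linarith
    · refine le_trans ?_ ((le_max_right _ _).trans hidx1)
      have h1 := (integral_kernel_mul_le (κ := fun t s => kt t s) hktm hΨ hktb hkt0
        (hNsup p hp hpR.le) t).trans
        (mul_le_mul_of_nonneg_left (setIntegral_le_Kstar hΨ hktb t) hsup0)
      have a1 := mul_le_mul (mul_le_mul_of_nonneg_left (le_supNorm hγ₁'c t) hη₁) hH₁
        (hh₁_nonneg p hp) (mul_nonneg hη₁ ((hγ_nonneg t t.2).2.2.1.trans (le_supNorm hγ₁'c t)))
      have a2 := mul_le_mul (mul_le_mul_of_nonneg_left (le_supNorm hγ₂'c t) hη₂) hH₂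
        (hh₂_nonneg p hp) (mul_nonneg hη₂ ((hγ_nonneg t t.2).2.2.2.trans (le_supNorm hγ₂'c t)))
      have a3 := mul_le_mul_of_nonneg_left h1 hlam
      rw [hT2]
      linarith
  obtain ⟨M₁, hM₁⟩ := exists_upper_bound_on_ball hh₁_bdd R
  obtain ⟨M₂, hM₂⟩ := exists_upper_bound_on_ball hh₂_bdd R
  have hLK := hLc.isCompact_closure_image_closedBall (fSup f R)
  obtain ⟨p, hp, hpR, hTp⟩ := exists_fixedPoint_of_norm_le_on_sphere convex_coneP isClosed_coneP
    zero_mem_coneP (fun c hc x hx => smul_mem_coneP hc hx) hR hTc hTP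
    (((isCompact_Icc (a := (0:ℝ)) (b := M₁)).prod ((isCompact_Icc (a := (0:ℝ)) (b := M₂)).prod
      hLK)).image (f := fun x : ℝ × ℝ × E => (η₁ * x.1) • G₁ + (η₂ * x.2.1) • G₂ + lam • x.2.2)
      (by fun_prop))
    (fun p hp => ⟨(h₁ p, h₂ p, L (N p)), ⟨⟨hh₁_nonneg p hp.1, hM₁ p hp⟩,
      ⟨hh₂_nonneg p hp.1, hM₂ p hp⟩, subset_closure ⟨N p, hNball p hp, rfl⟩⟩, rfl⟩) hTR
  refine ⟨p, hp, ?_, hpR, fun t => ?_⟩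
  · by_contra! hpr
    have h1 := le_integral_kernel_mul (κ := fun t s => k t s)
      (fun t => (hkm t).aestronglyMeasurable) hΦ hkb hk0 (hNinf p hp hpr.le) 1
    rw [hK] at h1
    have hγ := hγ_nonneg 1 (right_mem_Icc.2 zero_le_one)
    have a1 := mul_nonneg (mul_nonneg hη₁ (hh₁_nonneg p hp)) hγ.1
    have a2 := mul_nonneg (mul_nonneg hη₂ (hh₂_nonneg p hp)) hγ.2.1
    have a3 := mul_le_mul_of_nonneg_left h1 hlam
    have a4 := mul_le_mul_of_nonneg_left (min_le_left (Kconst k) (Kstar kt))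
      (mul_nonneg hlam hinf0)
    have a5 := hT1 p 1
    rw [hTp, Icc.coe_one] at a5
    rw [Icc.coe_one] at a3
    linarith [apply_fst_le_norm p 1]
  · have h1 := hT1 p t
    rw [hTp] at h1
    rw [h1, ← setIntegral_I01_eq, setIntegral_congr_fun measurableSet_Icc fun s hs => ?_]
    · ring
    · rw [ext01_apply (N p) ⟨s, hs⟩, hNcone p hp, ext01_apply p.1 ⟨s, hs⟩,
        ext01_apply p.2 ⟨s, hs⟩]
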